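/- In the q-shuffle algebra V on letters x, y, define W_{−k} = (xy)^k x and G̃ₖ = (xy)^k (G̃₀ = 1). Then for every natural number n, q^{-1} Σ_{k=0}^{2n+1} (−1)^k W_{−k} ⋆ G̃_{2n+1−k} = (−1)^n [2]_q^{2n+1} (xxyy)^n xxy = q Σ_{k=0}^{2n+1} (−1)^k G̃_{2n+1−k} ⋆ W_{−k}, where [2]_q = q + q^{-1}. -/

import Mathlib

noncomputable section

/-- The letter `x`. -/
def bX : Bool := false
/-- The letter `y`. -/
def bY : Bool := true

/-- The bilinear pairing on letters: `⟨x,x⟩ = ⟨y,y⟩ = 2`, `⟨x,y⟩ = ⟨y,x⟩ = -2`. -/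
def qbr (a b : Bool) : ℤ := if a = b then 2 else -2

/-- The sum `⟨a, w₁⟩ + ⋯ + ⟨a, wₙ⟩` for a letter `a` and a word `w`. -/
def qE (a : Bool) (w : List Bool) : ℤ := (w.map (qbr a)).sum

/-- Linear map on the free algebra (words-indexed finsupps) given by prepending a letter. -/
def qcons (F : Type*) [Field F] (a : Bool) :
    (List Bool →₀ F) →ₗ[F] (List Bool →₀ F) :=
  Finsupp.lmapDomain F F (List.cons a)

/-- The q-shuffle product of two words, as an element of the free algebra `List Bool →₀ F`.
Defined by the recursion `u ⋆ v = u₁((u₂⋯u_r) ⋆ v) + q^{⟨v₁,u₁⟩+⋯+⟨v₁,u_r⟩} v₁(u ⋆ (v₂⋯v_s))`. -/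
def qsh {F : Type*} [Field F] (q : F) : List Bool → List Bool → (List Bool →₀ F)
  | [], v => Finsupp.single v 1
  | a :: u, [] => Finsupp.single (a :: u) 1
  | a :: u, b :: v =>
      qcons F a (qsh q u (b :: v)) +
        (q ^ (qbr b a + qE b u)) • qcons F b (qsh q (a :: u) v)
  termination_by u v => u.length + v.length
  decreasing_by all_goals (simp only [List.length_cons]; omega)

/-- Concatenation power of a word. -/
def wpow (w : List Bool) : ℕ → List Bool
  | 0 => []
  | n + 1 => w ++ wpow w n

def wXXYY : List Bool := [bX, bX, bY, bY]
def wYYXX : List Bool := [bY, bY, bX, bX]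
def wXY : List Bool := [bX, bY]
def wYX : List Bool := [bY, bX]

def wA (k : ℕ) : List Bool := wpow wXY k ++ [bX]
def wB : ℕ → List Bool
  | 0 => []
  | k + 1 => bY :: wA k
def wC (k : ℕ) : List Bool := wpow wXY k
def wD (k : ℕ) : List Bool := bY :: wC k

theorem wA_eq (k : ℕ) : wA k = bX :: wB k := by
  cases k <;> simp [wA, wB, wpow, wXY]
theorem wB_succ (k : ℕ) : wB (k+1) = bY :: wA k := rfl
theorem wB_zero : wB 0 = [] := rfl
theorem wC_zero : wC 0 = [] := rfl
theorem wC_succ (k : ℕ) : wC (k+1) = bX :: wD k := by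
  simp [wC, wD, wpow, wXY]
theorem wD_eq (k : ℕ) : wD k = bY :: wC k := rfl

theorem qE_cons (a b : Bool) (w : List Bool) : qE a (b :: w) = qbr a b + qE a w := by
  simp [qE]

theorem qE_C (a : Bool) (k : ℕ) : qE a (wC k) = 0 := by
  induction k with
  | zero => simp [wC_zero, qE]
  | succ k ih =>
    rw [wC_succ, wD_eq, qE_cons, qE_cons, ih]
    cases a <;> simp [qbr, bX, bY]
theorem qE_D (a : Bool) (k : ℕ) : qE a (wD k) = qbr a bY := by
  rw [wD_eq, qE_cons, qE_C, add_zero]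
theorem qE_B (a : Bool) (k : ℕ) : qE a (wB k) = 0 := by
  induction k with
  | zero => simp [wB_zero, qE]
  | succ k ih =>
    rw [wB_succ, wA_eq, qE_cons, qE_cons, ih]
    cases a <;> simp [qbr, bX, bY]
theorem qE_A (a : Bool) (k : ℕ) : qE a (wA k) = qbr a bX := by
  rw [wA_eq, qE_cons, qE_B, add_zero]

section
variable {F : Type*} [Field F] (q : F)

theorem qsh_nil_left (v : List Bool) : qsh q [] v = Finsupp.single v 1 := by
  rw [qsh]
theorem qsh_nil_right (v : List Bool) : qsh q v [] = Finsupp.single v 1 := by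
  cases v <;> rw [qsh]
theorem qsh_cc (a b : Bool) (u v : List Bool) : qsh q (a :: u) (b :: v) =
      qcons F a (qsh q u (b :: v)) +
        (q ^ (qE b (a :: u))) • qcons F b (qsh q (a :: u) v) := by
  rw [qsh, qE_cons]
theorem qcons_single (a : Bool) (v : List Bool) (c : F) :
    qcons F a (Finsupp.single v c) = Finsupp.single (a :: v) c := by
  simp [qcons, Finsupp.lmapDomain_apply, Finsupp.mapDomain_single]

abbrev VV (F : Type*) [Field F] := List Bool →₀ F

/-- alternating sum -/
def alt (f : ℕ → ℕ → VV F) (N : ℕ) : VV F :=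
  ∑ p ∈ Finset.HasAntidiagonal.antidiagonal N, ((-1 : F) ^ p.1) • f p.1 p.2

theorem alt_zero (f : ℕ → ℕ → VV F) : alt f 0 = f 0 0 := by simp [alt]

theorem alt_add (f g : ℕ → ℕ → VV F) (N : ℕ) :
    alt (fun k m => f k m + g k m) N = alt f N + alt g N := by
  simp [alt, Finset.sum_add_distrib]
theorem alt_smul (c : F) (f : ℕ → ℕ → VV F) (N : ℕ) :
    alt (fun k m => c • f k m) N = c • alt f N := by
  simp only [alt, Finset.smul_sum, smul_comm c]
theorem alt_map (L : VV F →ₗ[F] VV F) (f : ℕ → ℕ → VV F) (N : ℕ) :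
    alt (fun k m => L (f k m)) N = L (alt f N) := by
  simp [alt, map_sum]
theorem alt_succ_left (f : ℕ → ℕ → VV F) (N : ℕ) :
    alt f (N+1) = f 0 (N+1) - alt (fun k m => f (k+1) m) N := by
  simp [alt, Finset.Nat.sum_antidiagonal_succ, pow_succ, sub_eq_add_neg]
theorem alt_succ_right (f : ℕ → ℕ → VV F) (N : ℕ) :
    alt f (N+1) = (-1 : F)^(N+1) • f (N+1) 0 + alt (fun k m => f k (m+1)) N := by
  simp [alt, Finset.Nat.sum_antidiagonal_succ']

theorem alt_S {f g h : ℕ → ℕ → VV F} (h0 : ∀ k, f k 0 = g k 0)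
    (h1 : ∀ k m, f k (m+1) = g k (m+1) + h k m) (N : ℕ) :
    alt f (N+1) = alt g (N+1) + alt h N := by
  rw [alt_succ_right, alt_succ_right g]
  simp only [h0, h1, alt_add]
  abel
theorem alt_R {f g h : ℕ → ℕ → VV F} (h0 : ∀ m, f 0 m = h 0 m)
    (h1 : ∀ k m, f (k+1) m = g k m + h (k+1) m) (N : ℕ) :
    alt f (N+1) = -alt g N + alt h (N+1) := by
  rw [alt_succ_left, alt_succ_left h]
  simp only [h0, h1, alt_add]
  abel
theorem alt_P {f g h : ℕ → ℕ → VV F} (h0 : ∀ m, f 0 (m+1) = h 0 m)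
    (h0' : ∀ k, f (k+1) 0 = g k 0)
    (h1 : ∀ k m, f (k+1) (m+1) = g k (m+1) + h (k+1) m) (N : ℕ) :
    alt f (N+1) = -alt g N + alt h N := by
  have e1 : alt f (N+1) =
      alt (fun k m => match k with | 0 => 0 | k+1 => g k m) (N+1)
       + alt (fun k m => match m with | 0 => 0 | m+1 => h k m) (N+1) := by
    rw [← alt_add]
    unfold alt
    refine Finset.sum_congr rfl ?_
    rintro ⟨k, m⟩ hp
    rw [Finset.HasAntidiagonal.mem_antidiagonal] at hp
    rcases k with _ | k <;> rcases m with _ | m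
    · simp at hp
    · simp [h0]
    · simp [h0']
    · simp [h1]
  rw [e1, alt_succ_left, alt_succ_right]
  simp

theorem fin1 (hq : q ≠ 0) (c d : F) (hcd : c * d = (q + q⁻¹)^2) (S R : ℕ → VV F)
    (hS : ∀ N, S (N+1) = c • qcons F bX (qcons F bX (R N)))
    (hR : ∀ N, R (N+1) = -(d • qcons F bY (qcons F bY (S N))))
    (hR0 : R 0 = Finsupp.single [bY] 1) (n : ℕ) :
    S (2*n+1) = (c * ((-1)^n * (q + q⁻¹)^(2*n))) •
      Finsupp.single (wpow wXXYY n ++ [bX, bX, bY]) (1 : F) := by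
  induction n with
  | zero => simp [hS, hR0, qcons_single, wpow]
  | succ n ih =>
    rw [show 2*(n+1)+1 = (2*n+1)+1+1 by ring, hS, hR, ih]
    simp only [map_neg, map_smul, qcons_single, smul_neg, smul_smul]
    rw [← neg_smul]
    have : -(c * (d * (c * ((-1)^n * (q + q⁻¹)^(2*n))))) =
       c * ((-1)^(n+1) * (q + q⁻¹)^(2*(n+1))) := by
      rw [show 2*(n+1) = 2*n+2 by ring, pow_add _ (2*n) 2, ← hcd]; ring
    rw [this]
    simp [wpow, wXXYY]

theorem part1 (hq : q ≠ 0) (n : ℕ) : alt (fun k m => qsh q (wA k) (wC m)) (2*n+1) =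
    ((1 + q^2) * ((-1)^n * (q + q⁻¹)^(2*n))) •
      Finsupp.single (wpow wXXYY n ++ [bX, bX, bY]) (1 : F) := by
  set S := alt (fun k m => qsh q (wA k) (wC m)) with hSd
  set P := alt (fun k m => qsh q (wB k) (wC m)) with hPd
  set Q := alt (fun k m => qsh q (wA k) (wD m)) with hQd
  set R := alt (fun k m => qsh q (wB k) (wD m)) with hRd
  have hS : ∀ N, S (N+1) = qcons F bX (P (N+1)) + q^2 • qcons F bX (Q N) := by
    intro N
    rw [hPd, hQd, ← alt_map, ← alt_map, ← alt_smul]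
    refine alt_S ?_ ?_ N
    · intro k
      simp only [wC_zero, qsh_nil_right, qcons_single, wA_eq]
    · intro k m
      simp only [wC_succ, wA_eq, qsh_cc]
      simp only [← wC_succ, ← wA_eq, qE_A]
      simp [qbr]; try norm_cast
  have hP : ∀ N, P (N+1) = -qcons F bY (S N) + qcons F bX (R N) := by
    intro N
    rw [hSd, hRd, ← alt_map, ← alt_map]
    refine alt_P ?_ ?_ ?_ N
    · intro m
      simp only [wB_zero, qsh_nil_left, qcons_single, wC_succ]
    · intro k
      simp only [wC_zero, qsh_nil_right, qcons_single, wB_succ]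
    · intro k m
      simp only [wC_succ, wB_succ, qsh_cc]
      simp only [← wC_succ, ← wB_succ, qE_B]
      simp
  have hQ : ∀ N, Q N = qcons F bX (R N) + (q^2)⁻¹ • qcons F bY (S N) := by
    intro N
    rw [hSd, hRd, ← alt_map, ← alt_map, ← alt_smul, ← alt_add, hQd]
    congr 1
    funext k m
    simp only [wD_eq, wA_eq, qsh_cc]
    simp only [← wD_eq, ← wA_eq, qE_A]
    simp [qbr, bX, bY]; try norm_cast
  have hR : ∀ N, R (N+1) = -qcons F bY (Q N) + qcons F bY (P (N+1)) := by
    intro N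
    rw [hPd, hQd, ← alt_map, ← alt_map]
    refine alt_R ?_ ?_ N
    · intro m
      simp only [wB_zero, qsh_nil_left, qcons_single, wD_eq]
    · intro k m
      simp only [wD_eq, wB_succ, qsh_cc]
      simp only [← wD_eq, ← wB_succ, qE_B]
      simp
  have q2 : q^2 ≠ 0 := pow_ne_zero _ hq
  refine fin1 q hq (1 + q^2) (1 + (q^2)⁻¹) (by field_simp; ring) S R ?_ ?_ ?_ n
  · intro N
    rw [hS, hP, hQ]
    simp only [map_add, map_neg, map_smul, smul_add, smul_smul, mul_inv_cancel₀ q2, add_smul, one_smul]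
    abel
  · intro N
    rw [hR, hP, hQ]
    simp only [map_add, map_neg, map_smul, smul_add, smul_smul, add_smul, one_smul]
    abel
  · rw [hRd, alt_zero, wB_zero, qsh_nil_left, wD_eq, wC_zero]

theorem part2 (hq : q ≠ 0) (n : ℕ) : alt (fun k m => qsh q (wC m) (wA k)) (2*n+1) =
    ((1 + (q^2)⁻¹) * ((-1)^n * (q + q⁻¹)^(2*n))) •
      Finsupp.single (wpow wXXYY n ++ [bX, bX, bY]) (1 : F) := by
  set S := alt (fun k m => qsh q (wC m) (wA k)) with hSd
  set P := alt (fun k m => qsh q (wC m) (wB k)) with hPd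
  set Q := alt (fun k m => qsh q (wD m) (wA k)) with hQd
  set R := alt (fun k m => qsh q (wD m) (wB k)) with hRd
  have hS : ∀ N, S (N+1) = qcons F bX (P (N+1)) + qcons F bX (Q N) := by
    intro N
    rw [hPd, hQd, ← alt_map, ← alt_map]
    refine alt_S ?_ ?_ N
    · intro k
      simp only [wC_zero, qsh_nil_left, qcons_single, wA_eq]
    · intro k m
      simp only [wC_succ, wA_eq, qsh_cc]
      simp only [← wC_succ, ← wA_eq, qE_C]
      simp [add_comm]
  have hP : ∀ N, P (N+1) = -qcons F bY (S N) + qcons F bX (R N) := by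
    intro N
    rw [hSd, hRd, ← alt_map, ← alt_map]
    refine alt_P ?_ ?_ ?_ N
    · intro m
      simp only [wB_zero, qsh_nil_right, qcons_single, wC_succ]
    · intro k
      simp only [wC_zero, qsh_nil_left, qcons_single, wB_succ]
    · intro k m
      simp only [wC_succ, wB_succ, qsh_cc]
      simp only [← wC_succ, ← wB_succ, qE_C]
      simp [add_comm]
  have hQ : ∀ N, Q N = (q^2)⁻¹ • qcons F bX (R N) + qcons F bY (S N) := by
    intro N
    rw [hSd, hRd, ← alt_map, ← alt_map, ← alt_smul, ← alt_add, hQd]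
    congr 1
    funext k m
    simp only [wD_eq, wA_eq, qsh_cc]
    simp only [← wD_eq, ← wA_eq, qE_D]
    simp [qbr, bX, bY, add_comm]; try norm_cast
  have hR : ∀ N, R (N+1) = -(q^2 • qcons F bY (Q N)) + qcons F bY (P (N+1)) := by
    intro N
    rw [hPd, hQd, ← alt_map, ← alt_map, ← alt_smul]
    refine alt_R ?_ ?_ N
    · intro m
      simp only [wB_zero, qsh_nil_right, qcons_single, wD_eq]
    · intro k m
      simp only [wD_eq, wB_succ, qsh_cc]
      simp only [← wD_eq, ← wB_succ, qE_D]
      simp [qbr, add_comm]; try norm_cast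
  have q2 : q^2 ≠ 0 := pow_ne_zero _ hq
  refine fin1 q hq (1 + (q^2)⁻¹) (1 + q^2) (by field_simp; ring) S R ?_ ?_ ?_ n
  · intro N
    rw [hS, hP, hQ]
    simp only [map_add, map_neg, map_smul, smul_add, smul_smul, add_smul, one_smul]
    abel
  · intro N
    rw [hR, hP, hQ]
    simp only [map_add, map_neg, map_smul, smul_add, smul_smul, mul_inv_cancel₀ q2, add_smul, one_smul]
    abel
  · rw [hRd, alt_zero, wB_zero, qsh_nil_right, wD_eq, wC_zero]

end

/-- `q^{-1} Σ_{k=0}^{2n+1} (−1)^k W_{−k} ⋆ G̃_{2n+1−k} = (−1)^n [2]_q^{2n+1} (xxyy)^n xxy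
     = q Σ_{k=0}^{2n+1} (−1)^k G̃_{2n+1−k} ⋆ W_{−k}`. -/
theorem stmt12 {F : Type*} [Field F] [CharZero F] (q : F) (hq : q ≠ 0)
    (hq1 : ∀ m : ℕ, 0 < m → q ^ m ≠ 1) (n : ℕ) :
    (q⁻¹ • ∑ k ∈ Finset.range (2 * n + 2),
        ((-1 : F) ^ k) • qsh q (wpow wXY k ++ [bX]) (wpow wXY (2 * n + 1 - k))
      = ((-1 : F) ^ n * (q + q⁻¹) ^ (2 * n + 1)) •
          Finsupp.single (wpow wXXYY n ++ [bX, bX, bY]) (1 : F)) ∧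
    (q • ∑ k ∈ Finset.range (2 * n + 2),
        ((-1 : F) ^ k) • qsh q (wpow wXY (2 * n + 1 - k)) (wpow wXY k ++ [bX])
      = ((-1 : F) ^ n * (q + q⁻¹) ^ (2 * n + 1)) •
          Finsupp.single (wpow wXXYY n ++ [bX, bX, bY]) (1 : F)) := by
  have e1 := part1 q hq n
  have e2 := part2 q hq n
  unfold alt at e1 e2
  rw [Finset.Nat.sum_antidiagonal_eq_sum_range_succ_mk] at e1 e2
  simp only [wA, wC] at e1 e2
  constructor
  · refine (congrArg (fun z => q⁻¹ • z) e1).trans ?_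
    rw [smul_smul]
    congr 1
    rw [pow_succ (q + q⁻¹) (2 * n)]
    have : q⁻¹ * (1 + q^2) = q + q⁻¹ := by field_simp; ring
    rw [← mul_assoc, this]; ring
  · refine (congrArg (fun z => q • z) e2).trans ?_
    rw [smul_smul]
    congr 1
    rw [pow_succ (q + q⁻¹) (2 * n)]
    have : q * (1 + (q^2)⁻¹) = q + q⁻¹ := by field_simp
    rw [← mul_assoc, this]; ring
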